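/- For all natural numbers m ≥ 1 and T ≥ 0, the number of sequences (j₀, j₁, …, j_m) of integers with j₀ = 0 and Σ_{i=0}^{m−1} |j_{i+1} − j_i| ≤ T is at most 4^{m+T}. Moreover, for every δ > 0 there exists ℓ₀ > 0 such that whenever T ≥ ℓ₀ m, the number of such sequences is at most exp(δ (m + T)). -/

import Mathlib

open Finset in
/-- A two-sided partial geometric series is at most twice the full one-sided series. -/
theorem sum_Icc_pow_natAbs_le {x : ℝ} (hx0 : 0 ≤ x) (hx1 : x < 1) (T : ℕ) :
    ∑ d ∈ Icc (-(T : ℤ)) T, x ^ d.natAbs ≤ 2 / (1 - x) := by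
  have hmaps : ∀ d ∈ Icc (-(T : ℤ)) T, d.natAbs ∈ range (T + 1) := by
    intro d hd
    rw [mem_Icc] at hd
    rw [mem_range]
    omega
  calc ∑ d ∈ Icc (-(T : ℤ)) T, x ^ d.natAbs
      = ∑ k ∈ range (T + 1), ∑ d ∈ Icc (-(T : ℤ)) T with d.natAbs = k, x ^ d.natAbs :=
        (sum_fiberwise_of_maps_to hmaps _).symm
    _ ≤ ∑ k ∈ range (T + 1), 2 * x ^ k := by
        refine sum_le_sum fun k _ => ?_
        have hcard : #{d ∈ Icc (-(T : ℤ)) T | d.natAbs = k} ≤ 2 := by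
          refine (card_le_card (t := {(k : ℤ), -(k : ℤ)}) fun d hd => ?_).trans card_le_two
          rw [mem_filter] at hd
          rw [mem_insert, mem_singleton]
          omega
        rw [sum_congr rfl fun d hd => by rw [(mem_filter.1 hd).2], sum_const, nsmul_eq_mul]
        gcongr
        exact_mod_cast hcard
    _ ≤ 2 / (1 - x) := by
        rw [← mul_sum, div_eq_mul_inv, ← tsum_geometric_of_lt_one hx0 hx1]
        gcongr
        exact (summable_geometric_of_lt_one hx0 hx1).sum_le_tsum _ fun k _ => pow_nonneg hx0 k

/-- An integer sequence is determined by its first term and its increments. -/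
theorem eq_of_increments_eq {m : ℕ} {j j' : Fin (m + 1) → ℤ} (h0 : j 0 = j' 0)
    (h : ∀ i : Fin m, j i.succ - j i.castSucc = j' i.succ - j' i.castSucc) : j = j' := by
  funext i
  induction i using Fin.induction with
  | zero => exact h0
  | succ i ih => linarith [h i]

open Finset in
/-- Paths are at most as numerous as their vectors of increments. -/
theorem card_paths_le_card_increments (m T : ℕ) :
    Nat.card {j : Fin (m + 1) → ℤ // j 0 = 0 ∧
        (∑ i : Fin m, (j i.succ - j i.castSucc).natAbs) ≤ T} ≤
      #{d ∈ Fintype.piFinset fun _ : Fin m => Icc (-(T : ℤ)) T | ∑ i, (d i).natAbs ≤ T} := by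
  rw [← Fintype.card_coe, ← Nat.card_eq_fintype_card]
  refine Nat.card_le_card_of_injective
    (fun j => ⟨fun i => j.1 i.succ - j.1 i.castSucc, ?_⟩) fun j j' h => ?_
  · rw [mem_filter, Fintype.mem_piFinset]
    refine ⟨fun i => ?_, j.2.2⟩
    have hi := (single_le_sum (f := fun i : Fin m => (j.1 i.succ - j.1 i.castSucc).natAbs)
      (fun _ _ => Nat.zero_le _) (mem_univ i)).trans j.2.2
    rw [mem_Icc]
    omega
  · exact Subtype.ext (eq_of_increments_eq (j.2.1.trans j'.2.1.symm)
      fun i => congrFun (congrArg Subtype.val h) i)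

open Finset in
/-- Chernoff-type bound: weight each path by `x` to the power of its total increment. -/
theorem card_paths_mul_pow_le {x : ℝ} (hx0 : 0 ≤ x) (hx1 : x < 1) (m T : ℕ) :
    (Nat.card {j : Fin (m + 1) → ℤ // j 0 = 0 ∧
        (∑ i : Fin m, (j i.succ - j i.castSucc).natAbs) ≤ T} : ℝ) * x ^ T ≤
      (2 / (1 - x)) ^ m := by
  set P := Fintype.piFinset fun _ : Fin m => Icc (-(T : ℤ)) T
  calc _ ≤ (#{d ∈ P | ∑ i, (d i).natAbs ≤ T} : ℝ) * x ^ T := by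
        gcongr
        exact card_paths_le_card_increments m T
    _ ≤ ∑ d ∈ P with ∑ i, (d i).natAbs ≤ T, ∏ i, x ^ (d i).natAbs := by
        rw [← nsmul_eq_mul]
        refine card_nsmul_le_sum _ (fun d : Fin m → ℤ => ∏ i, x ^ (d i).natAbs) _ fun d hd => ?_
        rw [prod_pow_eq_pow_sum]
        exact pow_le_pow_of_le_one hx0 hx1.le (mem_filter.1 hd).2
    _ ≤ ∑ d ∈ P, ∏ i, x ^ (d i).natAbs :=
        sum_le_sum_of_subset_of_nonneg (filter_subset _ _)
          fun _ _ _ => prod_nonneg fun _ _ => pow_nonneg hx0 _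
    _ = ∏ _i : Fin m, ∑ d ∈ Icc (-(T : ℤ)) T, x ^ d.natAbs :=
        sum_prod_piFinset (Icc (-(T : ℤ)) T) fun (_ : Fin m) (d : ℤ) => x ^ d.natAbs
    _ ≤ (2 / (1 - x)) ^ m := by
        rw [prod_const, card_univ, Fintype.card_fin]
        exact pow_le_pow_left₀ (sum_nonneg fun _ _ => pow_nonneg hx0 _)
          (sum_Icc_pow_natAbs_le hx0 hx1 T) m

/-- Counting lemma for discretized paths: the number of integer sequences
`(j₀, …, j_m)` with `j₀ = 0` and total increment `Σ|j_{i+1} − j_i| ≤ T` is at most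
`4^{m+T}`; moreover, for every `δ > 0` there is `ℓ₀ > 0` such that if `T ≥ ℓ₀ m` the count
is at most `exp(δ (m + T))`. -/
theorem count_discretized_paths :
    (∀ m T : ℕ, 1 ≤ m →
      Nat.card {j : Fin (m + 1) → ℤ // j 0 = 0 ∧
        (∑ i : Fin m, (j i.succ - j i.castSucc).natAbs) ≤ T} ≤ 4 ^ (m + T)) ∧
    (∀ δ : ℝ, 0 < δ → ∃ l₀ : ℝ, 0 < l₀ ∧
      ∀ m T : ℕ, 1 ≤ m → l₀ * m ≤ (T : ℝ) →
        (Nat.card {j : Fin (m + 1) → ℤ // j 0 = 0 ∧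
          (∑ i : Fin m, (j i.succ - j i.castSucc).natAbs) ≤ T} : ℝ)
          ≤ Real.exp (δ * ((m : ℝ) + T))) := by
  constructor
  · intro m T _
    have h := card_paths_mul_pow_le (x := 1 / 2) (by norm_num) (by norm_num) m T
    rw [one_div_pow, mul_one_div, div_le_iff₀ (by positivity)] at h
    norm_num at h
    have h4 : (4 : ℝ) ^ m * 2 ^ T ≤ 4 ^ (m + T) := by
      rw [pow_add]
      gcongr
      norm_num
    exact_mod_cast h.trans h4
  · intro δ hδ
    set x := Real.exp (-(δ / 2)) with hx
    have hx0 : 0 < x := Real.exp_pos _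
    have hx1 : x < 1 := Real.exp_lt_one_iff.2 (by linarith)
    have hC : 1 < 2 / (1 - x) := by
      rw [lt_div_iff₀ (by linarith)]
      linarith
    have hlog : 0 < Real.log (2 / (1 - x)) := Real.log_pos hC
    refine ⟨2 * Real.log (2 / (1 - x)) / δ, by positivity, fun m T _ hT => ?_⟩
    have h := card_paths_mul_pow_le hx0.le hx1 m T
    rw [div_mul_eq_mul_div, div_le_iff₀ hδ] at hT
    have hxT : x ^ T = Real.exp (T * -(δ / 2)) := (Real.exp_nat_mul _ T).symm
    rw [hxT, ← Real.exp_log (zero_lt_one.trans hC), ← Real.exp_nat_mul,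
      ← le_div_iff₀ (Real.exp_pos _), ← Real.exp_sub] at h
    refine h.trans (Real.exp_le_exp.2 ?_)
    have hm : 0 ≤ δ * m := by positivity
    linarith
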